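/- arXiv:2003.01619 — 7 statements merged into one kernel-verified Lean document; each statement's English description precedes it below -/
import Mathlib

section
/- Let γ ∈ [-1,1], K ≥ 1, b ∈ [0, 1-K^{-1/4}], and let L := [0,1]×[b, b+K^{-1/4}]. Let f be an integrable function on ℝ² supported in L, and define f^L(x',y') := f(x' - γK^{-1/4}b y', b + K^{-1/4}y') (so f^L is supported in [-1,2]×[0,1]). Then for every ξ = (ξ₁,ξ₂,ξ₃) ∈ ℝ³ one has |E_γ f(ξ)| = K^{-1/4} |E_{γ/K^{1/2}} f^L(ξ₁ + bξ₃, (ξ₂ - bγξ₁)K^{-1/4}, ξ₃ K^{-1/4})|. -/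
open MeasureTheory Set

noncomputable section

/-- The perturbed saddle `φ_γ(x,y) = xy + (γ/3) y³`. -/
def phiG (γ : ℝ) (z : ℝ × ℝ) : ℝ := z.1 * z.2 + γ / 3 * z.2 ^ 3

/-- The Fourier extension operator for integrable functions on `ℝ²`:
`E_γ g(ξ) = ∫_{ℝ²} g(x,y) e^{i(ξ₁x + ξ₂y + ξ₃ φ_γ(x,y))} dx dy`. -/
def ExtFull (γ : ℝ) (g : ℝ × ℝ → ℂ) (ξ : ℝ × ℝ × ℝ) : ℂ :=
  ∫ z : ℝ × ℝ,
    g z * Complex.exp (Complex.I *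
      ((ξ.1 * z.1 + ξ.2.1 * z.2 + ξ.2.2 * phiG γ z : ℝ) : ℂ))

/-- Change of variables along the affine map `(x, y) ↦ (x - a y, b + c y)`, which has Jacobian `c`. -/
theorem integral_eq_smul_integral_comp_affine_shear {E : Type*} [NormedAddCommGroup E]
    [NormedSpace ℝ E] (a b : ℝ) {c : ℝ} (hc : 0 < c) (g : ℝ × ℝ → E) :
    ∫ z, g z = c • ∫ w : ℝ × ℝ, g (w.1 - a * w.2, b + c * w.2) := by
  let L : ℝ × ℝ →L[ℝ] ℝ × ℝ := LinearMap.toContinuousLinearMap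
    (Matrix.toLin (Module.Basis.finTwoProd ℝ) (Module.Basis.finTwoProd ℝ) !![1, -a; 0, c])
  have hL : ∀ w : ℝ × ℝ, ((0, b) : ℝ × ℝ) + L w = (w.1 - a * w.2, b + c * w.2) := by
    intro w
    simp [L, Matrix.toLin_finTwoProd_apply, sub_eq_add_neg]
  have hdet : L.det = c := by
    simp [L, Matrix.det_fin_two]
  have hderiv : ∀ w ∈ (univ : Set (ℝ × ℝ)),
      HasFDerivWithinAt (fun w : ℝ × ℝ => (w.1 - a * w.2, b + c * w.2)) L univ w := by
    intro w _
    simp_rw [← hL]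
    exact (L.hasFDerivAt.const_add _).hasFDerivWithinAt
  have hinj : InjOn (fun w : ℝ × ℝ => (w.1 - a * w.2, b + c * w.2)) univ := by
    rintro ⟨x, y⟩ - ⟨x', y'⟩ - h
    simp only [Prod.mk.injEq, add_right_inj, mul_right_inj' hc.ne'] at h
    obtain ⟨h, rfl⟩ := h
    simpa using h
  have hsurj : (fun w : ℝ × ℝ => (w.1 - a * w.2, b + c * w.2)) '' univ = univ := by
    refine image_univ_of_surjective fun z => ⟨(z.1 + a * ((z.2 - b) / c), (z.2 - b) / c), ?_⟩
    ext
    · simp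
    · simp [mul_div_cancel₀ _ hc.ne']
  have key := integral_image_eq_integral_abs_det_fderiv_smul volume MeasurableSet.univ
    hderiv hinj g
  rw [hsurj] at key
  simpa [hdet, abs_of_pos hc, integral_smul] using key

/-- Under the affine shear `(x, y) ↦ (x - γ c b y, b + c y)` the phase of `E_γ` becomes, up to an
additive constant, the phase of `E_{γ c²}` at the transformed frequency. -/
theorem phase_comp_affine_shear (γ b c : ℝ) (ξ : ℝ × ℝ × ℝ) (w : ℝ × ℝ) :
    ξ.1 * (w.1 - γ * c * b * w.2) + ξ.2.1 * (b + c * w.2)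
        + ξ.2.2 * phiG γ (w.1 - γ * c * b * w.2, b + c * w.2) =
      (ξ.2.1 * b + ξ.2.2 * (γ / 3 * b ^ 3)) +
        ((ξ.1 + b * ξ.2.2) * w.1 + (ξ.2.1 - b * γ * ξ.1) * c * w.2
          + ξ.2.2 * c * phiG (γ * c ^ 2) w) := by
  simp only [phiG]
  ring

/-- Parabolic rescaling of the extension operator along an affine shear, with the explicit
unimodular factor. -/
theorem ExtFull_eq_comp_affine_shear (γ b : ℝ) {c : ℝ} (hc : 0 < c) (f : ℝ × ℝ → ℂ)
    (ξ : ℝ × ℝ × ℝ) :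
    ExtFull γ f ξ = c • (Complex.exp (Complex.I * ((ξ.2.1 * b + ξ.2.2 * (γ / 3 * b ^ 3) : ℝ) : ℂ)) *
      ExtFull (γ * c ^ 2) (fun w => f (w.1 - γ * c * b * w.2, b + c * w.2))
        (ξ.1 + b * ξ.2.2, (ξ.2.1 - b * γ * ξ.1) * c, ξ.2.2 * c)) := by
  unfold ExtFull
  rw [integral_eq_smul_integral_comp_affine_shear (γ * c * b) b hc, ← integral_const_mul]
  congr 2
  ext w
  rw [phase_comp_affine_shear, Complex.ofReal_add, mul_add, Complex.exp_add]
  ring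

/-- Parabolic rescaling for a long horizontal strip `L = [0,1] × [b, b+K^{-1/4}]`:
if `f` is integrable and supported in `L` and
`f^L(x',y') := f(x' - γ K^{-1/4} b y', b + K^{-1/4} y')`, then
`|E_γ f(ξ)| = K^{-1/4} |E_{γ/K^{1/2}} f^L(ξ₁ + bξ₃, (ξ₂ - bγξ₁)K^{-1/4}, ξ₃ K^{-1/4})|`. -/
theorem rescaling_long_horizontal_strip
    (γ K b : ℝ) (hγ : γ ∈ Set.Icc (-1:ℝ) 1) (hK : 1 ≤ K)
    (hb : b ∈ Set.Icc (0:ℝ) (1 - K ^ (-(1:ℝ)/4)))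
    (f : ℝ × ℝ → ℂ) (hf : Integrable f)
    (hsupp : Function.support f ⊆
      Set.Icc (0:ℝ) 1 ×ˢ Set.Icc b (b + K ^ (-(1:ℝ)/4)))
    (fL : ℝ × ℝ → ℂ)
    (hfL : ∀ w : ℝ × ℝ,
      fL w = f (w.1 - γ * K ^ (-(1:ℝ)/4) * b * w.2, b + K ^ (-(1:ℝ)/4) * w.2)) :
    ∀ ξ : ℝ × ℝ × ℝ,
      ‖ExtFull γ f ξ‖ =
        K ^ (-(1:ℝ)/4) *
          ‖ExtFull (γ / K ^ ((1:ℝ)/2)) fL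
            (ξ.1 + b * ξ.2.2,
              (ξ.2.1 - b * γ * ξ.1) * K ^ (-(1:ℝ)/4),
              ξ.2.2 * K ^ (-(1:ℝ)/4))‖ := by
  intro ξ
  have hK0 : 0 < K := by linarith
  have hc : 0 < K ^ (-(1:ℝ)/4) := Real.rpow_pos_of_pos hK0 _
  have hγK : γ / K ^ ((1:ℝ)/2) = γ * (K ^ (-(1:ℝ)/4)) ^ 2 := by
    rw [← Real.rpow_mul_natCast hK0.le, div_eq_mul_inv, ← Real.rpow_neg hK0.le]
    norm_num
  rw [hγK, funext hfL, ExtFull_eq_comp_affine_shear γ b hc f ξ, norm_smul, norm_mul,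
    mul_comm Complex.I, Complex.norm_exp_ofReal_mul_I, one_mul, Real.norm_of_nonneg hc.le]

end
end

section
/- Let γ ∈ ℝ and K ≥ 1 with |γ|K^{1/2} ≤ 1, let a ∈ [0, 1-K^{-1/2}], and let L := [a, a+K^{-1/2}]×[0,1]. Let f be an integrable function on ℝ² supported in L, and define f^L(x',y) := f(a + K^{-1/2}x', y) (so f^L is supported in [0,1]²). Then for every ξ = (ξ₁,ξ₂,ξ₃) ∈ ℝ³ one has |E_γ f(ξ)| = K^{-1/2} |E_{γK^{1/2}} f^L(ξ₁K^{-1/2}, ξ₂ + aξ₃, ξ₃K^{-1/2})|. -/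
open MeasureTheory Set

noncomputable section

/-- Change of variables under an affine map of the first coordinate. -/
theorem integral_comp_affine_fst {E : Type*} [NormedAddCommGroup E] [NormedSpace ℝ E]
    (F : ℝ × ℝ → E) (a : ℝ) {s : ℝ} (hs : s ≠ 0) :
    ∫ w : ℝ × ℝ, F (a + s * w.1, w.2) = |s⁻¹| • ∫ z : ℝ × ℝ, F z := by
  have hmap : (volume : Measure ℝ).map (fun x => a + s * x) = ENNReal.ofReal |s⁻¹| • volume := by
    have hcomp : (fun x : ℝ => a + s * x) = (a + ·) ∘ (s * ·) := rfl
    rw [hcomp, ← Measure.map_map (measurable_const_add a) (measurable_const_mul s),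
      Real.map_volume_mul_left hs, Measure.map_smul, map_add_left_eq_self]
  have hemb : MeasurableEmbedding (fun x : ℝ => a + s * x) :=
    (measurableEmbedding_addLeft a).comp (measurableEmbedding_mulLeft₀ hs)
  have hprod : (volume : Measure (ℝ × ℝ)).map (Prod.map (fun x => a + s * x) id) =
      ENNReal.ofReal |s⁻¹| • volume := by
    rw [Measure.volume_eq_prod, ← Measure.map_prod_map _ _ hemb.measurable measurable_id, hmap,
      Measure.map_id, Measure.prod_smul_left]
  have key := (hemb.prodMap MeasurableEmbedding.id).integral_map (μ := volume) F
  rw [hprod, integral_smul_measure, ENNReal.toReal_ofReal (abs_nonneg _)] at key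
  exact key.symm

/-- Rescaling for a long vertical strip `L = [a, a+K^{-1/2}] × [0,1]`, valid when
`|γ| K^{1/2} ≤ 1`: if `f` is integrable, supported in `L`, and
`f^L(x',y) := f(a + K^{-1/2} x', y)`, then
`|E_γ f(ξ)| = K^{-1/2} |E_{γK^{1/2}} f^L(ξ₁ K^{-1/2}, ξ₂ + aξ₃, ξ₃ K^{-1/2})|`. -/
theorem rescaling_long_vertical_strip
    (γ K a : ℝ) (hK : 1 ≤ K) (hγK : |γ| * K ^ ((1:ℝ)/2) ≤ 1)
    (ha : a ∈ Set.Icc (0:ℝ) (1 - K ^ (-(1:ℝ)/2)))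
    (f : ℝ × ℝ → ℂ) (hf : Integrable f)
    (hsupp : Function.support f ⊆
      Set.Icc a (a + K ^ (-(1:ℝ)/2)) ×ˢ Set.Icc (0:ℝ) 1)
    (fL : ℝ × ℝ → ℂ)
    (hfL : ∀ w : ℝ × ℝ, fL w = f (a + K ^ (-(1:ℝ)/2) * w.1, w.2)) :
    ∀ ξ : ℝ × ℝ × ℝ,
      ‖ExtFull γ f ξ‖ =
        K ^ (-(1:ℝ)/2) *
          ‖ExtFull (γ * K ^ ((1:ℝ)/2)) fL
            (ξ.1 * K ^ (-(1:ℝ)/2),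
              ξ.2.1 + a * ξ.2.2,
              ξ.2.2 * K ^ (-(1:ℝ)/2))‖ := by
  intro ξ
  have hK0 : 0 < K := one_pos.trans_le hK
  set s : ℝ := K ^ (-(1:ℝ)/2) with hs_def
  have hs : 0 < s := Real.rpow_pos_of_pos hK0 _
  have hsK : s * K ^ ((1:ℝ)/2) = 1 := by
    rw [hs_def, ← Real.rpow_add hK0]
    norm_num
  have hphase (w : ℝ × ℝ) :
      ξ.1 * (a + s * w.1) + ξ.2.1 * w.2 + ξ.2.2 * phiG γ (a + s * w.1, w.2) =
        ξ.1 * a + (ξ.1 * s * w.1 + (ξ.2.1 + a * ξ.2.2) * w.2 +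
          ξ.2.2 * s * phiG (γ * K ^ ((1:ℝ)/2)) w) := by
    simp only [phiG]
    linear_combination (-(ξ.2.2 * γ / 3 * w.2 ^ 3)) * hsK
  have hchange := integral_comp_affine_fst (fun z : ℝ × ℝ => f z * Complex.exp (Complex.I *
    ((ξ.1 * z.1 + ξ.2.1 * z.2 + ξ.2.2 * phiG γ z : ℝ) : ℂ))) a hs.ne'
  have hpull : ∫ w : ℝ × ℝ, f (a + s * w.1, w.2) * Complex.exp (Complex.I *
      ((ξ.1 * (a + s * w.1) + ξ.2.1 * w.2 + ξ.2.2 * phiG γ (a + s * w.1, w.2) : ℝ) : ℂ)) =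
      Complex.exp (Complex.I * ((ξ.1 * a : ℝ) : ℂ)) * ExtFull (γ * K ^ ((1:ℝ)/2)) fL
        (ξ.1 * s, ξ.2.1 + a * ξ.2.2, ξ.2.2 * s) := by
    rw [ExtFull, ← integral_const_mul]
    refine integral_congr_ae (.of_forall fun w => ?_)
    simp only [hphase, hfL]
    rw [Complex.ofReal_add (ξ.1 * a), mul_add, Complex.exp_add]
    ring
  rw [hpull] at hchange
  have hnorm := congrArg norm hchange
  rw [norm_mul, Complex.norm_exp_I_mul_ofReal, one_mul, norm_smul, Real.norm_eq_abs, abs_abs,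
    abs_of_pos (inv_pos.2 hs)] at hnorm
  rw [hnorm, mul_inv_cancel_left₀ hs.ne']
  rfl

end
end

section
/- Let γ ∈ ℝ and K ≥ 1 with |γ|K^{1/2} ≤ 1, let a ∈ [0, 1-K^{-1/2}], b ∈ [0, 1-K^{-1/4}], and let L := [a, a+K^{-1/2}]×[b, b+K^{-1/4}]. Let f be an integrable function on ℝ² supported in L, and define f^L(x'',y'') := f(a + K^{-1/2}(x'' - γK^{1/4}b y''), b + K^{-1/4}y''). Then for every ξ = (ξ₁,ξ₂,ξ₃) ∈ ℝ³ one has |E_γ f(ξ)| = K^{-3/4} |E_γ f^L(K^{-1/2}(ξ₁ + bξ₃), K^{-1/4}(ξ₂ + aξ₃ - bγξ₁), K^{-3/4}ξ₃)|. -/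
open MeasureTheory Set

noncomputable section

theorem integral_comp_linearMap_eq_abs_det_inv_smul {E F : Type*} [NormedAddCommGroup E]
    [NormedSpace ℝ E] [MeasurableSpace E] [BorelSpace E] [FiniteDimensional ℝ E]
    [NormedAddCommGroup F] [NormedSpace ℝ F] (μ : Measure E) [μ.IsAddHaarMeasure]
    {T : E →ₗ[ℝ] E} (hT : LinearMap.det T ≠ 0) (g : E → F) (hg : AEStronglyMeasurable g μ) :
    ∫ w, g (T w) ∂μ = |(LinearMap.det T)⁻¹| • ∫ z, g z ∂μ := by
  have hmap := Measure.map_linearMap_addHaar_eq_smul_addHaar μ hT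
  have hTm : AEMeasurable T μ := T.continuous_of_finiteDimensional.measurable.aemeasurable
  rw [← integral_map hTm (by rw [hmap]; exact hg.smul_measure _), hmap, integral_smul_measure,
    ENNReal.toReal_ofReal (abs_nonneg _)]

/-- The linear part `(u, v) ↦ (r² u - c v, r v)` of the rescaling of a strip. -/
def stripLinearMap (r c : ℝ) : ℝ × ℝ →ₗ[ℝ] ℝ × ℝ :=
  Matrix.toLin (Module.Basis.finTwoProd ℝ) (Module.Basis.finTwoProd ℝ) !![r ^ 2, -c; 0, r]

theorem stripLinearMap_apply (r c : ℝ) (w : ℝ × ℝ) :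
    stripLinearMap r c w = (r ^ 2 * w.1 - c * w.2, r * w.2) := by
  simp [stripLinearMap, Matrix.toLin_finTwoProd_apply, sub_eq_add_neg]

theorem det_stripLinearMap (r c : ℝ) : LinearMap.det (stripLinearMap r c) = r ^ 3 := by
  simp only [stripLinearMap, LinearMap.det_toLin, Matrix.det_fin_two_of]
  ring

theorem norm_extFull_eq_mul_norm_extFull_rescaled {r : ℝ} (hr : 0 < r) (γ a b : ℝ)
    {f : ℝ × ℝ → ℂ} (hf : AEStronglyMeasurable f) (ξ : ℝ × ℝ × ℝ) :
    ‖ExtFull γ f ξ‖ = r ^ 3 *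
      ‖ExtFull γ (fun w => f ((a, b) + stripLinearMap r (γ * b * r) w))
        (r ^ 2 * (ξ.1 + b * ξ.2.2), r * (ξ.2.1 + a * ξ.2.2 - b * γ * ξ.1), r ^ 3 * ξ.2.2)‖ := by
  set G : ℝ × ℝ → ℂ := fun z => f z * Complex.exp (Complex.I *
      ((ξ.1 * z.1 + ξ.2.1 * z.2 + ξ.2.2 * phiG γ z : ℝ) : ℂ)) with hG
  have hGm : AEStronglyMeasurable G := by
    refine hf.mul (Continuous.aestronglyMeasurable ?_)
    unfold phiG
    fun_prop
  have hGt : AEStronglyMeasurable (fun z => G ((a, b) + z)) :=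
    hGm.comp_measurePreserving (measurePreserving_add_left volume (a, b))
  have hdet : LinearMap.det (stripLinearMap r (γ * b * r)) ≠ 0 := by
    rw [det_stripLinearMap]; positivity
  have hchange : ∫ w, G ((a, b) + stripLinearMap r (γ * b * r) w) = (r ^ 3)⁻¹ • ∫ z, G z := by
    rw [integral_comp_linearMap_eq_abs_det_inv_smul volume hdet _ hGt,
      integral_add_left_eq_self G (a, b), det_stripLinearMap, abs_of_pos (by positivity)]
  set θ : ℝ := ξ.1 * a + ξ.2.1 * b + ξ.2.2 * phiG γ (a, b) with hθ
  have hphase : ∫ w, G ((a, b) + stripLinearMap r (γ * b * r) w) = Complex.exp (Complex.I * θ) *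
      ExtFull γ (fun w => f ((a, b) + stripLinearMap r (γ * b * r) w))
        (r ^ 2 * (ξ.1 + b * ξ.2.2), r * (ξ.2.1 + a * ξ.2.2 - b * γ * ξ.1), r ^ 3 * ξ.2.2) := by
    rw [ExtFull, ← integral_const_mul]
    congr 1 with w
    simp only [hG]
    rw [mul_left_comm, ← Complex.exp_add, ← mul_add, ← Complex.ofReal_add]
    congr 4
    simp only [hθ, phiG, stripLinearMap_apply, Prod.fst_add, Prod.snd_add]
    ring
  have hnorm : ‖Complex.exp (Complex.I * θ)‖ = 1 := by
    rw [mul_comm, Complex.norm_exp_ofReal_mul_I]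
  have hnorms := congrArg norm (hphase.symm.trans hchange)
  rw [norm_mul, hnorm, one_mul, norm_smul, Real.norm_of_nonneg (by positivity)] at hnorms
  rw [hnorms, mul_inv_cancel_left₀ (by positivity)]
  rfl

/-- Rescaling for a short vertical strip `L = [a, a+K^{-1/2}] × [b, b+K^{-1/4}]`, valid
when `|γ| K^{1/2} ≤ 1`: if `f` is integrable, supported in `L`, and
`f^L(x'',y'') := f(a + K^{-1/2}(x'' - γK^{1/4}b y''), b + K^{-1/4} y'')`, then
`|E_γ f(ξ)| = K^{-3/4} |E_γ f^L(K^{-1/2}(ξ₁+bξ₃), K^{-1/4}(ξ₂+aξ₃-bγξ₁), K^{-3/4}ξ₃)|`;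
note that the parameter `γ` is unchanged. -/
theorem rescaling_short_vertical_strip
    (γ K a b : ℝ) (hK : 1 ≤ K) (hγK : |γ| * K ^ ((1:ℝ)/2) ≤ 1)
    (ha : a ∈ Set.Icc (0:ℝ) (1 - K ^ (-(1:ℝ)/2)))
    (hb : b ∈ Set.Icc (0:ℝ) (1 - K ^ (-(1:ℝ)/4)))
    (f : ℝ × ℝ → ℂ) (hf : Integrable f)
    (hsupp : Function.support f ⊆
      Set.Icc a (a + K ^ (-(1:ℝ)/2)) ×ˢ Set.Icc b (b + K ^ (-(1:ℝ)/4)))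
    (fL : ℝ × ℝ → ℂ)
    (hfL : ∀ w : ℝ × ℝ,
      fL w = f (a + K ^ (-(1:ℝ)/2) * (w.1 - γ * K ^ ((1:ℝ)/4) * b * w.2),
                b + K ^ (-(1:ℝ)/4) * w.2)) :
    ∀ ξ : ℝ × ℝ × ℝ,
      ‖ExtFull γ f ξ‖ =
        K ^ (-(3:ℝ)/4) *
          ‖ExtFull γ fL
            (K ^ (-(1:ℝ)/2) * (ξ.1 + b * ξ.2.2),
              K ^ (-(1:ℝ)/4) * (ξ.2.1 + a * ξ.2.2 - b * γ * ξ.1),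
              K ^ (-(3:ℝ)/4) * ξ.2.2)‖ := by
  intro ξ
  have hK0 : 0 < K := one_pos.trans_le hK
  set r : ℝ := K ^ (-(1:ℝ) / 4) with hr
  have hr0 : 0 < r := Real.rpow_pos_of_pos hK0 _
  have hr2 : K ^ (-(1:ℝ) / 2) = r ^ 2 := by
    rw [hr, ← Real.rpow_mul_natCast hK0.le]; norm_num
  have hr3 : K ^ (-(3:ℝ) / 4) = r ^ 3 := by
    rw [hr, ← Real.rpow_mul_natCast hK0.le]; norm_num
  have hrK : r * K ^ ((1:ℝ) / 4) = 1 := by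
    rw [hr, ← Real.rpow_add hK0]; norm_num
  have hfL' : fL = fun w => f ((a, b) + stripLinearMap r (γ * b * r) w) := by
    funext w
    rw [hfL, hr2, stripLinearMap_apply, Prod.mk_add_mk]
    congr 2
    linear_combination (-γ * b * r * w.2) * hrK
  rw [hr2, hr3, hfL']
  exact norm_extFull_eq_mul_norm_extFull_rescaled hr0 γ a b hf.aestronglyMeasurable ξ

end
end

section
/- For every γ ∈ ℝ and all points z = (x,y), z₁ = (x₁,y₁), z₂ = (x₂,y₂), z₁' = (x₁',y₁'), z₂' = (x₂',y₂') ∈ ℝ², the four-point transversality quantity Γ^γ_z(z₁,z₂,z₁',z₂') := ⟨(Hφ_γ(z))^{-1}(∇φ_γ(z₂) - ∇φ_γ(z₁)), ∇φ_γ(z₂') - ∇φ_γ(z₁')⟩ satisfies Γ^γ_z(z₁,z₂,z₁',z₂') = (y₂'-y₁')·t^γ_z(z₁,z₂) + (y₂-y₁)·t^γ_z(z₁',z₂'), where t^γ_z(z₁,z₂) := x₂-x₁ + γ(y₁+y₂-y)(y₂-y₁). -/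
open Matrix

noncomputable section

/-- The gradient `∇φ_γ(x,y) = (y, x + γy²)` of `φ_γ(x,y) = xy + (γ/3)y³`. -/
def gradPhi (γ : ℝ) (z : ℝ × ℝ) : Fin 2 → ℝ :=
  ![z.2, z.1 + γ * z.2 ^ 2]

/-- The Hessian `Hφ_γ(x,y) = [[0,1],[1,2γy]]`. -/
def hessPhi (γ : ℝ) (z : ℝ × ℝ) : Matrix (Fin 2) (Fin 2) ℝ :=
  !![0, 1; 1, 2 * γ * z.2]

/-- The four-point transversality quantity
`Γ^γ_z(z₁,z₂,z₁',z₂') = ⟨(Hφ_γ(z))⁻¹(∇φ_γ(z₂) - ∇φ_γ(z₁)), ∇φ_γ(z₂') - ∇φ_γ(z₁')⟩`. -/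
def GammaFour (γ : ℝ) (z z₁ z₂ z₁' z₂' : ℝ × ℝ) : ℝ :=
  ((hessPhi γ z)⁻¹ *ᵥ (gradPhi γ z₂ - gradPhi γ z₁)) ⬝ᵥ
    (gradPhi γ z₂' - gradPhi γ z₁')

/-- The quantity `t^γ_z(z₁,z₂) = x₂ - x₁ + γ(y₁+y₂-y)(y₂-y₁)`. -/
def tQuant (γ : ℝ) (z z₁ z₂ : ℝ × ℝ) : ℝ :=
  z₂.1 - z₁.1 + γ * (z₁.2 + z₂.2 - z.2) * (z₂.2 - z₁.2)

/-- The Hessian of `φ_γ` is invertible, with inverse `[[-2γy,1],[1,0]]`. -/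
theorem hessPhi_inv (γ : ℝ) (z : ℝ × ℝ) :
    (hessPhi γ z)⁻¹ = !![-(2 * γ * z.2), 1; 1, 0] := by
  apply Matrix.inv_eq_left_inv
  ext i j
  fin_cases i <;> fin_cases j <;> simp [hessPhi, Matrix.mul_apply, Fin.sum_univ_two]

/-- The four-point transversality quantity satisfies
`Γ^γ_z(z₁,z₂,z₁',z₂') = (y₂'-y₁')·t^γ_z(z₁,z₂) + (y₂-y₁)·t^γ_z(z₁',z₂')`. -/
theorem GammaFour_formula (γ : ℝ) (z z₁ z₂ z₁' z₂' : ℝ × ℝ) :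
    GammaFour γ z z₁ z₂ z₁' z₂' =
      (z₂'.2 - z₁'.2) * tQuant γ z z₁ z₂ + (z₂.2 - z₁.2) * tQuant γ z z₁' z₂' := by
  rw [GammaFour, hessPhi_inv]
  simp only [gradPhi, tQuant, Matrix.mulVec, dotProduct, Fin.sum_univ_two, Pi.sub_apply,
    Matrix.of_apply, Matrix.cons_val_zero, Matrix.cons_val_one]
  ring

end
end

section
/- Let K ≥ 20, μ ≥ 1, and γ ∈ [-1,1]. Let (z_k)_{k} = ((x_k, y_k))_k be a finite family of points in [0,1]² such that for all k ≠ m one has min{|y_m - y_k|, max{|t^γ_{z_m}(z_m,z_k)|, |t^γ_{z_k}(z_m,z_k)|}} ≤ 10μ^{1/2}K^{-1}. Then: (a) if |γ|K^{1/2} > 1, there is an index k₀ such that |y_k - y_{k₀}| ≤ 5μ^{1/2}K^{-1/4} for all k; (b) if |γ|K^{1/2} ≤ 1, there is an index k₀ such that either |y_k - y_{k₀}| ≤ 10μ^{1/2}K^{-1} for all k, or |x_k - x_{k₀}| ≤ 15μ^{1/2}K^{-1/2} for all k. -/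
noncomputable section

/-- If two points are not strongly separated at scale `δ` but their second coordinates are more
than `δ` apart, then `γ (y₂ - y₁)²` and `x₂ - x₁` are controlled. -/
lemma bounds_of_min_tQuant_le {γ δ : ℝ} {p q : ℝ × ℝ}
    (hq : q.2 ∈ Set.Icc (0:ℝ) 1)
    (h : min |p.2 - q.2| (max |tQuant γ p p q| |tQuant γ q p q|) ≤ δ)
    (hd : δ < |q.2 - p.2|) :
    |γ| * |q.2 - p.2| ^ 2 ≤ 2 * δ ∧ |q.1 - p.1| ≤ δ + |γ| * |q.2 - p.2| := by
  rcases min_le_iff.1 h with h | h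
  · rw [abs_sub_comm] at h
    exact absurd h (not_le.2 hd)
  obtain ⟨h₁, h₂⟩ := max_le_iff.1 h
  have hy : |q.2| ≤ 1 := abs_le.2 ⟨by linarith [hq.1], hq.2⟩
  constructor
  · have e : γ * (q.2 - p.2) ^ 2 = tQuant γ p p q - tQuant γ q p q := by
      unfold tQuant; ring
    rw [← abs_pow, ← abs_mul, e]
    linarith [abs_sub (tQuant γ p p q) (tQuant γ q p q)]
  · have e : q.1 - p.1 = tQuant γ p p q - γ * (q.2 - p.2) * q.2 := by
      unfold tQuant; ring
    have h₃ : |γ * (q.2 - p.2) * q.2| ≤ |γ| * |q.2 - p.2| := by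
      rw [abs_mul, abs_mul]
      exact mul_le_of_le_one_right (by positivity) hy
    rw [e]
    linarith [abs_sub (tQuant γ p p q) (γ * (q.2 - p.2) * q.2)]

/-- If points with far second coordinates have close first coordinates, then the family lies in
a horizontal strip or in a vertical strip, each centred at one of its members. -/
lemma exists_horizontal_or_vertical_strip {ι : Type*} [Nonempty ι] {x y : ι → ℝ} {δ ρ : ℝ}
    (hρ : 0 ≤ ρ) (h : ∀ k m, δ < |y k - y m| → |x k - x m| ≤ ρ) :
    ∃ k₀, (∀ k, |y k - y k₀| ≤ δ) ∨ ∀ k, |x k - x k₀| ≤ 3 * ρ := by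
  by_cases hs : ∃ k₀, ∀ k, |y k - y k₀| ≤ δ
  · exact hs.imp fun _ => Or.inl
  push Not at hs
  obtain ⟨a⟩ := ‹Nonempty ι›
  obtain ⟨b, hb⟩ := hs a
  have hba := h b a hb
  refine ⟨a, Or.inr fun k => ?_⟩
  obtain ⟨c, hc⟩ := hs k
  have hck := h c k hc
  by_cases hka : δ < |y k - y a|
  · linarith [h k a hka]
  by_cases hkb : δ < |y k - y b|
  · linarith [h k b hkb, abs_sub_le (x k) (x b) (x a)]
  rw [abs_sub_comm] at hck
  by_cases hca : δ < |y c - y a|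
  · linarith [h c a hca, abs_sub_le (x k) (x c) (x a)]
  by_cases hcb : δ < |y c - y b|
  · linarith [h c b hcb, abs_sub_le (x k) (x c) (x a), abs_sub_le (x c) (x b) (x a)]
  exfalso
  simp only [not_lt, abs_le] at hka hkb hca hcb
  rcases lt_abs.1 hb with hb | hb <;> rcases lt_abs.1 hc with hc | hc <;> linarith

/-- The Geometric Lemma: if no two points of a finite family in `[0,1]²` are strongly
separated at scale `10 μ^{1/2} K⁻¹`, then (a) when `|γ| K^{1/2} > 1` the family lies in a
horizontal strip of width `10 μ^{1/2} K^{-1/4}` around one of its members, and (b) when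
`|γ| K^{1/2} ≤ 1` it lies in a horizontal strip of width `20 μ^{1/2} K⁻¹` or in a vertical
strip of width `30 μ^{1/2} K^{-1/2}` around one of its members. -/
theorem geometric_lemma
    (γ μ K : ℝ) (hγ : γ ∈ Set.Icc (-1:ℝ) 1) (hμ : 1 ≤ μ) (hK : 20 ≤ K)
    {ι : Type*} [Fintype ι] [Nonempty ι]
    (z : ι → ℝ × ℝ) (hz : ∀ k, z k ∈ Set.Icc (0:ℝ) 1 ×ˢ Set.Icc (0:ℝ) 1)
    (hsep : ∀ k m, k ≠ m →
      min |(z m).2 - (z k).2|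
        (max |tQuant γ (z m) (z m) (z k)| |tQuant γ (z k) (z m) (z k)|) ≤
      10 * Real.sqrt μ * K⁻¹) :
    (|γ| * K ^ ((1:ℝ)/2) > 1 →
      ∃ k₀, ∀ k, |(z k).2 - (z k₀).2| ≤ 5 * Real.sqrt μ * K ^ (-(1:ℝ)/4)) ∧
    (|γ| * K ^ ((1:ℝ)/2) ≤ 1 →
      ∃ k₀, (∀ k, |(z k).2 - (z k₀).2| ≤ 10 * Real.sqrt μ * K⁻¹) ∨
            (∀ k, |(z k).1 - (z k₀).1| ≤ 15 * Real.sqrt μ * K ^ (-(1:ℝ)/2))) := by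
  have hK0 : (0:ℝ) < K := by linarith
  have hs : 1 ≤ √μ := Real.one_le_sqrt.2 hμ
  set s := √μ
  have hpair : ∀ k m, 10 * s * K⁻¹ < |(z k).2 - (z m).2| →
      |γ| * |(z k).2 - (z m).2| ^ 2 ≤ 2 * (10 * s * K⁻¹) ∧
        |(z k).1 - (z m).1| ≤ 10 * s * K⁻¹ + |γ| * |(z k).2 - (z m).2| := by
    intro k m hd
    rcases eq_or_ne k m with rfl | hkm
    · rw [sub_self, abs_zero] at hd
      exact absurd hd (not_lt.2 (by positivity))
    · exact bounds_of_min_tQuant_le (hz k).2 (hsep k m hkm) hd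
  constructor
  · intro hlarge
    obtain ⟨k₀⟩ := ‹Nonempty ι›
    refine ⟨k₀, fun k => ?_⟩
    set w := K ^ (-(1:ℝ) / 4) with hw_def
    have hw : 0 < w := by positivity
    have hw4 : w ^ 4 = K⁻¹ := by
      rw [hw_def, ← Real.rpow_natCast, ← Real.rpow_mul hK0.le, ← Real.rpow_neg_one]
      norm_num
    have hw2 : K ^ ((1:ℝ) / 2) * w ^ 2 = 1 := by
      rw [hw_def, ← Real.rpow_natCast, ← Real.rpow_mul hK0.le, ← Real.rpow_add hK0]
      norm_num
    have hγw : w ^ 2 < |γ| := by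
      have := mul_lt_mul_of_pos_right hlarge (pow_pos hw 2)
      rwa [mul_assoc, hw2, mul_one, one_mul] at this
    have hwK : w ^ 4 ≤ 1 / 20 := by
      rw [hw4, inv_eq_one_div]
      exact one_div_le_one_div_of_le (by norm_num) hK
    have hw3 : w ^ 3 ≤ 1 / 2 := by
      have : w ≤ 1 / 2 := le_of_pow_le_pow_left₀ (n := 4) (by norm_num) (by norm_num) (by linarith)
      calc w ^ 3 ≤ (1 / 2) ^ 3 := by gcongr
        _ ≤ 1 / 2 := by norm_num
    by_cases hd : 10 * s * K⁻¹ < |(z k).2 - (z k₀).2|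
    · have h₁ := (hpair k k₀ hd).1
      rw [← hw4] at h₁
      have h₂ : w ^ 2 * |(z k).2 - (z k₀).2| ^ 2 ≤ w ^ 2 * (20 * s * w ^ 2) := by
        calc _ ≤ |γ| * |(z k).2 - (z k₀).2| ^ 2 := by gcongr
          _ ≤ _ := by linarith
      have h₃ := le_of_mul_le_mul_left h₂ (pow_pos hw 2)
      refine le_of_sq_le_sq ?_ (by positivity)
      nlinarith [mul_nonneg (sub_nonneg.2 hs) (pow_pos hw 2).le,
        mul_nonneg (mul_nonneg (sub_nonneg.2 hs) (by linarith : 0 ≤ s)) (pow_pos hw 2).le]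
    · rw [← hw4] at hd
      nlinarith [mul_le_mul_of_nonneg_left hw3 (by positivity : 0 ≤ s * w)]
  · intro hsmall
    set v := K ^ (-(1:ℝ) / 2) with hv_def
    have hv : 0 < v := by positivity
    have hv2 : v ^ 2 = K⁻¹ := by
      rw [hv_def, ← Real.rpow_natCast, ← Real.rpow_mul hK0.le, ← Real.rpow_neg_one]
      norm_num
    have hv1 : K ^ ((1:ℝ) / 2) * v = 1 := by
      rw [hv_def, ← Real.rpow_add hK0]
      norm_num
    have hγv : |γ| ≤ v := by
      have := mul_le_mul_of_nonneg_right hsmall hv.le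
      rwa [mul_assoc, hv1, mul_one, one_mul] at this
    have hvK : v ^ 2 ≤ 1 / 20 := by
      rw [hv2, inv_eq_one_div]
      exact one_div_le_one_div_of_le (by norm_num) hK
    have hv_le : v ≤ 2 / 5 := by nlinarith
    have hx : ∀ k m, 10 * s * K⁻¹ < |(z k).2 - (z m).2| → |(z k).1 - (z m).1| ≤ 5 * s * v := by
      intro k m hd
      have h₁ := (hpair k m hd).2
      have hy : |(z k).2 - (z m).2| ≤ 1 := by
        have hk := (hz k).2
        have hm := (hz m).2
        exact abs_le.2 ⟨by linarith [hk.1, hm.2], by linarith [hk.2, hm.1]⟩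
      have h₂ : |γ| * |(z k).2 - (z m).2| ≤ v :=
        (mul_le_of_le_one_right (abs_nonneg γ) hy).trans hγv
      rw [← hv2] at h₁
      nlinarith [mul_le_mul_of_nonneg_left hv_le (by positivity : 0 ≤ s * v),
        mul_nonneg (sub_nonneg.2 hs) hv.le]
    obtain ⟨k₀, h⟩ := exists_horizontal_or_vertical_strip (x := fun k => (z k).1)
      (y := fun k => (z k).2) (by positivity) hx
    exact ⟨k₀, h.imp_right fun h k => (h k).trans_eq (by ring)⟩

end
end

section
/- Let γ ∈ [-1,1], μ ≥ 1, K ≥ 1, and let τ₁, τ₂ ⊆ [0,1]² be axis-parallel squares of side length at most μ^{1/2}K^{-1} which are strongly separated. Then for all z₁ = (x₁,y₁) ∈ τ₁ and z₂ = (x₂,y₂) ∈ τ₂ one has |∇φ_γ(z₂) - ∇φ_γ(z₁)| ≥ |y₂ - y₁| ≥ 8μ^{1/2}K^{-1}; consequently there is an absolute constant c > 0 such that the angle between the normal vectors N_γ(z₁) and N_γ(z₂) is at least c·μ^{1/2}K^{-1}. -/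
noncomputable section

/-- The gradient `∇φ_γ(x,y) = (y, x + γy²)` of `φ_γ(x,y) = xy + (γ/3)y³`, as a vector in
Euclidean space `ℝ²`. -/
def gradPhiE (γ : ℝ) (z : ℝ × ℝ) : EuclideanSpace ℝ (Fin 2) :=
  (WithLp.equiv 2 (Fin 2 → ℝ)).symm ![z.2, z.1 + γ * z.2 ^ 2]

/-- The normal vector `N_γ(x,y) = (∂ₓφ_γ, ∂_yφ_γ, -1) = (y, x + γy², -1)` to the graph of
`φ_γ` at `(x, y, φ_γ(x,y))`, as a vector in Euclidean space `ℝ³`. -/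
def normalPhi (γ : ℝ) (z : ℝ × ℝ) : EuclideanSpace ℝ (Fin 3) :=
  (WithLp.equiv 2 (Fin 3 → ℝ)).symm ![z.2, z.1 + γ * z.2 ^ 2, -1]

/-- The axis-parallel square with center `c` and side length `s`. -/
def sqCap (c : ℝ × ℝ) (s : ℝ) : Set (ℝ × ℝ) :=
  Set.Icc (c.1 - s / 2) (c.1 + s / 2) ×ˢ Set.Icc (c.2 - s / 2) (c.2 + s / 2)

/-- Strong separation of two caps with centers `c₁`, `c₂` at scale `10 μ^{1/2} K⁻¹`. -/
def StronglySeparated (γ μ K : ℝ) (c₁ c₂ : ℝ × ℝ) : Prop :=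
  10 * Real.sqrt μ * K⁻¹ ≤
    min |c₂.2 - c₁.2| (max |tQuant γ c₁ c₁ c₂| |tQuant γ c₂ c₁ c₂|)

theorem abs_sub_snd_le_norm_gradPhiE_sub (γ : ℝ) (z₁ z₂ : ℝ × ℝ) :
    |z₂.2 - z₁.2| ≤ ‖gradPhiE γ z₂ - gradPhiE γ z₁‖ := by
  simpa [gradPhiE] using PiLp.norm_apply_le (gradPhiE γ z₂ - gradPhiE γ z₁) 0

theorem inner_normalPhi (γ : ℝ) (z w : ℝ × ℝ) :
    inner ℝ (normalPhi γ z) (normalPhi γ w) =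
      z.2 * w.2 + (z.1 + γ * z.2 ^ 2) * (w.1 + γ * w.2 ^ 2) + 1 := by
  simp [normalPhi, PiLp.inner_apply, Fin.sum_univ_three]
  ring

theorem norm_normalPhi_sq_le {γ : ℝ} (hγ : γ ∈ Set.Icc (-1 : ℝ) 1) {z : ℝ × ℝ}
    (hz : z ∈ Set.Icc (0 : ℝ) 1 ×ˢ Set.Icc (0 : ℝ) 1) : ‖normalPhi γ z‖ ^ 2 ≤ 6 := by
  obtain ⟨⟨hx0, hx1⟩, hy0, hy1⟩ := hz
  have hy : z.2 ^ 2 ≤ 1 := pow_le_one₀ hy0 hy1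
  have hlow : -1 ≤ γ * z.2 ^ 2 := by nlinarith [hγ.1, sq_nonneg z.2]
  have hup : γ * z.2 ^ 2 ≤ 1 := by nlinarith [hγ.2, sq_nonneg z.2]
  have hv : (z.1 + γ * z.2 ^ 2) ^ 2 ≤ 2 ^ 2 := sq_le_sq' (by linarith) (by linarith)
  rw [← real_inner_self_eq_norm_sq, inner_normalPhi]
  nlinarith

/-- For normals at points of the unit square, `|y₂ - y₁| ≤ |N₁ × N₂| = |N₁| |N₂| sin θ ≤ 6 θ`. -/
theorem abs_sub_snd_le_six_mul_angle {γ : ℝ} (hγ : γ ∈ Set.Icc (-1 : ℝ) 1) {z₁ z₂ : ℝ × ℝ}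
    (hz₁ : z₁ ∈ Set.Icc (0 : ℝ) 1 ×ˢ Set.Icc (0 : ℝ) 1)
    (hz₂ : z₂ ∈ Set.Icc (0 : ℝ) 1 ×ˢ Set.Icc (0 : ℝ) 1) :
    |z₂.2 - z₁.2| ≤ 6 * InnerProductGeometry.angle (normalPhi γ z₁) (normalPhi γ z₂) := by
  set θ := InnerProductGeometry.angle (normalPhi γ z₁) (normalPhi γ z₂)
  have hsin : Real.sin θ * (‖normalPhi γ z₁‖ * ‖normalPhi γ z₂‖) = _ :=
    InnerProductGeometry.sin_angle_mul_norm_mul_norm (normalPhi γ z₁) (normalPhi γ z₂)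
  have hcross : |z₂.2 - z₁.2| ≤ Real.sin θ * (‖normalPhi γ z₁‖ * ‖normalPhi γ z₂‖) := by
    rw [hsin]
    apply Real.abs_le_sqrt
    simp only [inner_normalPhi]
    nlinarith [sq_nonneg ((z₂.1 + γ * z₂.2 ^ 2) - (z₁.1 + γ * z₁.2 ^ 2)),
      sq_nonneg (z₁.2 * (z₂.1 + γ * z₂.2 ^ 2) - z₂.2 * (z₁.1 + γ * z₁.2 ^ 2))]
  have hnorm : ‖normalPhi γ z₁‖ * ‖normalPhi γ z₂‖ ≤ 6 := by
    nlinarith [sq_nonneg (‖normalPhi γ z₁‖ - ‖normalPhi γ z₂‖), norm_normalPhi_sq_le hγ hz₁,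
      norm_normalPhi_sq_le hγ hz₂]
  have hθ : 0 ≤ θ := InnerProductGeometry.angle_nonneg _ _
  calc |z₂.2 - z₁.2| ≤ Real.sin θ * (‖normalPhi γ z₁‖ * ‖normalPhi γ z₂‖) := hcross
    _ ≤ θ * 6 := by
      gcongr
      exact Real.sin_le hθ
    _ = 6 * θ := mul_comm _ _

theorem abs_snd_sub_snd_le_of_mem_sqCap {c z : ℝ × ℝ} {s : ℝ} (hz : z ∈ sqCap c s) :
    |z.2 - c.2| ≤ s / 2 :=
  abs_le.2 ⟨by linarith [hz.2.1], by linarith [hz.2.2]⟩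

/-- Angular separation of normals for strongly separated caps: there is an absolute
constant `c > 0` such that for strongly separated caps `τ₁, τ₂ ⊆ [0,1]²` of side length at
most `μ^{1/2}K⁻¹` and all `z₁ ∈ τ₁`, `z₂ ∈ τ₂`, one has
`|∇φ_γ(z₂) - ∇φ_γ(z₁)| ≥ |y₂ - y₁| ≥ 8 μ^{1/2} K⁻¹`, and the angle between `N_γ(z₁)` and
`N_γ(z₂)` is at least `c μ^{1/2} K⁻¹`. -/
theorem angle_separation_of_strongly_separated :
    ∃ c : ℝ, 0 < c ∧
      ∀ (γ μ K : ℝ), γ ∈ Set.Icc (-1:ℝ) 1 → 1 ≤ μ → 1 ≤ K →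
      ∀ (c₁ c₂ : ℝ × ℝ) (s₁ s₂ : ℝ), 0 < s₁ → 0 < s₂ →
        s₁ ≤ Real.sqrt μ * K⁻¹ → s₂ ≤ Real.sqrt μ * K⁻¹ →
        sqCap c₁ s₁ ⊆ Set.Icc (0:ℝ) 1 ×ˢ Set.Icc (0:ℝ) 1 →
        sqCap c₂ s₂ ⊆ Set.Icc (0:ℝ) 1 ×ˢ Set.Icc (0:ℝ) 1 →
        StronglySeparated γ μ K c₁ c₂ →
        ∀ z₁ ∈ sqCap c₁ s₁, ∀ z₂ ∈ sqCap c₂ s₂,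
          |z₂.2 - z₁.2| ≤ ‖gradPhiE γ z₂ - gradPhiE γ z₁‖ ∧
          8 * Real.sqrt μ * K⁻¹ ≤ |z₂.2 - z₁.2| ∧
          c * Real.sqrt μ * K⁻¹ ≤
            InnerProductGeometry.angle (normalPhi γ z₁) (normalPhi γ z₂) := by
  refine ⟨1, one_pos, ?_⟩
  intro γ μ K hγ _ _ c₁ c₂ s₁ s₂ _ _ hs₁ hs₂ hsub₁ hsub₂ hsep z₁ hz₁ z₂ hz₂
  have hc : 10 * Real.sqrt μ * K⁻¹ ≤ |c₂.2 - c₁.2| := hsep.trans (min_le_left _ _)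
  have hz₁c := abs_snd_sub_snd_le_of_mem_sqCap hz₁
  have hz₂c := abs_snd_sub_snd_le_of_mem_sqCap hz₂
  have htri : |c₂.2 - c₁.2| ≤ |z₂.2 - z₁.2| + |z₁.2 - c₁.2| + |z₂.2 - c₂.2| := by
    have h₁ := abs_sub_le c₂.2 z₂.2 c₁.2
    have h₂ := abs_sub_le z₂.2 z₁.2 c₁.2
    rw [abs_sub_comm c₂.2 z₂.2] at h₁
    linarith
  have hy : 8 * Real.sqrt μ * K⁻¹ ≤ |z₂.2 - z₁.2| := by linarith
  have hangle := abs_sub_snd_le_six_mul_angle hγ (hsub₁ hz₁) (hsub₂ hz₂)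
  exact ⟨abs_sub_snd_le_norm_gradPhiE_sub γ z₁ z₂, hy, by linarith⟩
end
end

section
/- Let P be a nonzero real polynomial on ℝ³ of degree at most D, let Z(P) := {ξ ∈ ℝ³ : P(ξ) = 0}, let r > 0, let W := {ξ ∈ ℝ³ : dist(ξ, Z(P)) ≤ r}, and let T ⊂ ℝ³ be the closed r-neighborhood of a line segment (a tube of radius r). Then the number of connected components O of ℝ³ \ Z(P) for which T ∩ (O \ W) ≠ ∅ is at most D + 1. -/
open MeasureTheory Set

noncomputable section

/-- The zero variety `Z(P) ⊆ ℝ³` of a real polynomial `P` in three variables. -/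
def zeroVariety (P : MvPolynomial (Fin 3) ℝ) : Set (EuclideanSpace ℝ (Fin 3)) :=
  {ξ | MvPolynomial.eval (fun i => ξ i) P = 0}

open Polynomial in
/-- The restriction of a polynomial to a parametrized line is a univariate polynomial whose degree
is at most the total degree. -/
lemma exists_polynomial_eval_lineMap {ι : Type*} [Fintype ι] (P : MvPolynomial ι ℝ)
    (a b : EuclideanSpace ℝ ι) :
    ∃ q : ℝ[X], q.natDegree ≤ P.totalDegree ∧
      ∀ t, q.eval t = MvPolynomial.eval (fun i => AffineMap.lineMap a b t i) P := by
  refine ⟨MvPolynomial.aeval (fun i => C (b i - a i) * X + C (a i)) P, ?_, fun t => ?_⟩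
  · simpa using MvPolynomial.aeval_natDegree_le P le_rfl
      (fun i => C (b i - a i) * X + C (a i)) (fun i => natDegree_linear_le)
  · rw [← Polynomial.coe_evalRingHom, MvPolynomial.aeval_def, MvPolynomial.hom_eval₂,
      MvPolynomial.eval, MvPolynomial.coe_eval₂Hom]
    congr 1
    · ext; simp
    · ext i; simp [AffineMap.lineMap_apply]; ring

/-- If the closed `r`-ball around `x` avoids `Z` and `x` lies within `r` of the compact set `K`,
then the connected component of `x` in the complement of `Z` meets `K`. -/
lemma exists_mem_connectedComponentIn_compl_of_infDist {E : Type*} [NormedAddCommGroup E]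
    [NormedSpace ℝ E] {Z K : Set E} {r : ℝ} {x : E} (hr : 0 ≤ r) (hK : IsCompact K)
    (hK' : K.Nonempty) (hxK : Metric.infDist x K ≤ r) (hxZ : r < Metric.infDist x Z) :
    ∃ y ∈ K, y ∈ connectedComponentIn Zᶜ x := by
  obtain ⟨y, hyK, hy⟩ := hK.exists_infDist_eq_dist hK' x
  refine ⟨y, hyK, ?_⟩
  refine (convex_closedBall x r).isPreconnected.subset_connectedComponentIn
    (Metric.mem_closedBall_self hr) ?_ ?_
  · intro z hz hzZ
    have h := Metric.infDist_le_dist_of_mem (x := x) hzZ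
    rw [Metric.mem_closedBall, dist_comm] at hz
    linarith
  · rw [Metric.mem_closedBall, dist_comm]
    linarith

/-- If equally many roots of `q` lie strictly below `s` and `t`, and `t` is not a root, then `q`
has no root in `[s, t]`. -/
lemma eval_ne_zero_of_card_roots_lt_eq {q : Polynomial ℝ} (hq : q ≠ 0) {s t u : ℝ}
    (ht : q.eval t ≠ 0)
    (h : (q.roots.toFinset.filter (· < s)).card = (q.roots.toFinset.filter (· < t)).card)
    (hsu : s ≤ u) (hut : u ≤ t) : q.eval u ≠ 0 := by
  intro hu
  have hne : u ≠ t := fun h => ht (h ▸ hu)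
  have hsub : q.roots.toFinset.filter (· < s) ⊂ q.roots.toFinset.filter (· < t) := by
    refine (Finset.ssubset_iff_of_subset fun z hz => ?_).2 ⟨u, ?_, ?_⟩
    · simp only [Finset.mem_filter] at hz ⊢
      exact ⟨hz.1, by linarith⟩
    · simp [hq, hu, lt_of_le_of_ne hut hne]
    · simp [hsu]
  exact (Finset.card_lt_card hsub).ne h

/-- The cell-crossing bound for tubes: let `P ≠ 0` have degree at most `D`, let `W` be the
`r`-neighborhood of `Z(P)`, and let `T` be the closed `r`-neighborhood of a segment. Then
the number of connected components `O` of `ℝ³ \ Z(P)` with `T ∩ (O \ W) ≠ ∅` is at most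
`D + 1`. -/
theorem tube_meets_few_cells
    (P : MvPolynomial (Fin 3) ℝ) (hP : P ≠ 0) (D : ℕ) (hD : P.totalDegree ≤ D)
    (r : ℝ) (hr : 0 < r) (a b : EuclideanSpace ℝ (Fin 3)) :
    letI Z := zeroVariety P
    letI W := {ξ : EuclideanSpace ℝ (Fin 3) | Metric.infDist ξ Z ≤ r}
    letI T := {ξ : EuclideanSpace ℝ (Fin 3) | Metric.infDist ξ (segment ℝ a b) ≤ r}
    letI S := {O : Set (EuclideanSpace ℝ (Fin 3)) |
      (∃ ξ ∈ Zᶜ, O = connectedComponentIn Zᶜ ξ) ∧ (T ∩ (O \ W)).Nonempty}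
    S.Finite ∧ S.ncard ≤ D + 1 := by
  set Z := zeroVariety P
  set S := {O : Set (EuclideanSpace ℝ (Fin 3)) | _}
  obtain ⟨q, hqdeg, hq⟩ := exists_polynomial_eval_lineMap P a b
  have hqZ (t : ℝ) : q.eval t ≠ 0 ↔ AffineMap.lineMap a b t ∈ Zᶜ := by
    rw [hq]; rfl
  have hS : ∀ O ∈ S, ∃ t : ℝ, q.eval t ≠ 0 ∧
      O = connectedComponentIn Zᶜ (AffineMap.lineMap a b t) := by
    rintro _ ⟨⟨ξ, -, rfl⟩, x, hxT, hxO, hxW⟩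
    have hcompact : IsCompact (segment ℝ a b) := by
      rw [segment_eq_image_lineMap]
      exact isCompact_Icc.image AffineMap.lineMap_continuous
    obtain ⟨y, hy, hyx⟩ := exists_mem_connectedComponentIn_compl_of_infDist hr.le hcompact
      ⟨a, left_mem_segment ℝ a b⟩ hxT (not_le.1 hxW)
    rw [segment_eq_image_lineMap] at hy
    obtain ⟨t, -, rfl⟩ := hy
    exact ⟨t, (hqZ t).2 (connectedComponentIn_subset _ _ hyx),
      (connectedComponentIn_eq hxO).trans (connectedComponentIn_eq hyx)⟩
  choose! τ hτ hτO using hS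
  let N (t : ℝ) : ℕ := (q.roots.toFinset.filter (· < t)).card
  have hN (t : ℝ) : N t ∈ (Finset.range (D + 1) : Set ℕ) := by
    have h := Finset.card_filter_le q.roots.toFinset (· < t)
    have h' := q.roots.toFinset_card_le
    have h'' := q.card_roots'
    simp only [Finset.coe_range, mem_Iio, N]
    omega
  have hcomp {s t : ℝ} (hst : s ≤ t) (ht : q.eval t ≠ 0) (h : N s = N t) :
      connectedComponentIn Zᶜ (AffineMap.lineMap a b s) =
        connectedComponentIn Zᶜ (AffineMap.lineMap a b t) := by
    have hq0 : q ≠ 0 := by rintro rfl; simp at ht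
    refine connectedComponentIn_eq ?_
    refine (isPreconnected_Icc.image _
      AffineMap.lineMap_continuous.continuousOn).subset_connectedComponentIn
      (mem_image_of_mem _ (left_mem_Icc.2 hst)) ?_ (mem_image_of_mem _ (right_mem_Icc.2 hst))
    rintro _ ⟨u, hu, rfl⟩
    exact (hqZ u).1 (eval_ne_zero_of_card_roots_lt_eq hq0 ht h hu.1 hu.2)
  have hinj : InjOn (fun O => N (τ O)) S := by
    intro O hO O' hO' h
    rw [hτO O hO, hτO O' hO']
    rcases le_total (τ O) (τ O') with hle | hle
    · exact hcomp hle (hτ O' hO') h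
    · exact (hcomp hle (hτ O hO) h.symm).symm
  have hmaps : MapsTo (fun O => N (τ O)) S (Finset.range (D + 1) : Set ℕ) := fun O _ => hN _
  refine ⟨Set.Finite.of_injOn hmaps hinj (Finset.finite_toSet _), ?_⟩
  simpa only [ncard_coe_finset, Finset.card_range] using
    ncard_le_ncard_of_injOn _ hmaps hinj (Finset.finite_toSet _)

end
end
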